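/- arXiv:2402.13787 — 8 statements merged into one kernel-verified Lean document; each statement's English description precedes it below -/
import Mathlib

section
/- In the BPAM link-probability setting, assume 0 < α < 1, 0 < r < 1, and 0 ≤ ρ ≤ 1. Then q_BB ≥ q_RB, with equality if and only if ρ = 1. (This is the key inequality showing that the HITS mean-field multiplicative factor of the majority community dominates that of the minority community, MF^(t)(B) ≥ MF^(t)(R), in Proposition 3.4.) -/
/-- In the BPAM link-probability setting, with `0 < α < 1`, `0 < r < 1`, `0 ≤ ρ ≤ 1`,
the backward–forward step probabilities satisfy `q_BB ≥ q_RB`, with equality iff `ρ = 1`. -/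
theorem bpam_qBB_ge_qRB
    (α r ρ : ℝ) (hα0 : 0 < α) (hα1 : α < 1) (hr0 : 0 < r) (hr1 : r < 1)
    (hρ0 : 0 ≤ ρ) (hρ1 : ρ ≤ 1)
    (u u' D1 D2 p_out_BB p_out_RB p_in_BB p_in_BR p_in_RR p_in_RB q_BB q_RB : ℝ)
    (hu : u = α * ρ + 1 - α) (hu' : u' = α + ρ * (1 - α))
    (hD1 : D1 = r * ρ * u + (1 - r) * u') (hD2 : D2 = r * u + ρ * (1 - r) * u')
    (hpoBB : p_out_BB = (1 - α) / u) (hpoRB : p_out_RB = ρ * (1 - α) / u')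
    (hpiBB : p_in_BB = (1 - r) * u' / D1) (hpiBR : p_in_BR = r * ρ * u / D1)
    (hpiRR : p_in_RR = r * u / D2) (hpiRB : p_in_RB = ρ * (1 - r) * u' / D2)
    (hqBB : q_BB = p_in_BB * p_out_BB + p_in_BR * p_out_RB)
    (hqRB : q_RB = p_in_RB * p_out_BB + p_in_RR * p_out_RB) :
    q_BB ≥ q_RB ∧ (q_BB = q_RB ↔ ρ = 1) := by
  have hu_pos : 0 < u := by rw [hu]; nlinarith [mul_nonneg hα0.le hρ0]
  have hu'_pos : 0 < u' := by rw [hu']; nlinarith [mul_nonneg hρ0 (sub_pos.2 hα1).le]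
  have hr1' : 0 < 1 - r := sub_pos.2 hr1
  have hα1' : 0 < 1 - α := sub_pos.2 hα1
  have hD1_pos : 0 < D1 := by rw [hD1]; positivity
  have hD2_pos : 0 < D2 := by rw [hD2]; positivity
  have hin : p_in_BB - p_in_RB = r * (1 - r) * u * u' * (1 - ρ ^ 2) / (D1 * D2) := by
    rw [hpiBB, hpiRB, div_sub_div _ _ hD1_pos.ne' hD2_pos.ne']
    congr 1
    rw [hD1, hD2]
    ring
  have hout : p_out_BB - p_out_RB = α * (1 - α) * (1 - ρ ^ 2) / (u * u') := by
    rw [hpoBB, hpoRB, div_sub_div _ _ hu_pos.ne' hu'_pos.ne']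
    congr 1
    rw [hu, hu']
    ring
  have hBB : p_in_BB + p_in_BR = 1 := by
    rw [hpiBB, hpiBR, ← add_div, div_eq_one_iff_eq hD1_pos.ne', hD1]
    ring
  have hRB : p_in_RB + p_in_RR = 1 := by
    rw [hpiRB, hpiRR, ← add_div, div_eq_one_iff_eq hD2_pos.ne', hD2]
    ring
  have hdiff : q_BB - q_RB =
      r * (1 - r) * α * (1 - α) / (D1 * D2) * (1 - ρ ^ 2) ^ 2 := by
    calc q_BB - q_RB = (p_in_BB - p_in_RB) * (p_out_BB - p_out_RB) := by
          rw [hqBB, hqRB, eq_sub_of_add_eq' hBB, eq_sub_of_add_eq' hRB]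
          ring
      _ = _ := by
          rw [hin, hout]
          field_simp
  have hcoef : 0 < r * (1 - r) * α * (1 - α) / (D1 * D2) := by positivity
  refine ⟨sub_nonneg.1 (hdiff ▸ by positivity), ?_⟩
  rw [← sub_eq_zero, hdiff, mul_eq_zero_iff_left hcoef.ne', sq_eq_zero_iff, sub_eq_zero,
    eq_comm, pow_eq_one_iff_of_nonneg hρ0 two_ne_zero]
end

section
/- In the BPAM link-probability setting, assume u ≠ 0, u' ≠ 0, D1 ≠ 0, and D2 ≠ 0. Then q_BB − q_RB = r·(1 − r)·α·(1 − α)·(1 − ρ²)² / (D1·D2). -/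
/-- Closed form for the gap `q_BB − q_RB` of backward–forward step probabilities in the BPAM. -/
theorem bpam_qBB_sub_qRB_closed_form
    (α r ρ : ℝ)
    (u u' D1 D2 p_out_BB p_out_RB p_in_BB p_in_BR p_in_RR p_in_RB q_BB q_RB : ℝ)
    (hu : u = α * ρ + 1 - α) (hu' : u' = α + ρ * (1 - α))
    (hD1 : D1 = r * ρ * u + (1 - r) * u') (hD2 : D2 = r * u + ρ * (1 - r) * u')
    (hune : u ≠ 0) (hu'ne : u' ≠ 0) (hD1ne : D1 ≠ 0) (hD2ne : D2 ≠ 0)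
    (hpoBB : p_out_BB = (1 - α) / u) (hpoRB : p_out_RB = ρ * (1 - α) / u')
    (hpiBB : p_in_BB = (1 - r) * u' / D1) (hpiBR : p_in_BR = r * ρ * u / D1)
    (hpiRR : p_in_RR = r * u / D2) (hpiRB : p_in_RB = ρ * (1 - r) * u' / D2)
    (hqBB : q_BB = p_in_BB * p_out_BB + p_in_BR * p_out_RB)
    (hqRB : q_RB = p_in_RB * p_out_BB + p_in_RR * p_out_RB) :
    q_BB - q_RB = r * (1 - r) * α * (1 - α) * (1 - ρ ^ 2) ^ 2 / (D1 * D2) := by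
  have hin : p_in_BB - p_in_RB = r * (1 - r) * u * u' * (1 - ρ ^ 2) / (D1 * D2) := by
    rw [hpiBB, hpiRB]
    field_simp
    rw [hD1, hD2]
    ring
  have hout : p_out_BB - p_out_RB = α * (1 - α) * (1 - ρ ^ 2) / (u * u') := by
    rw [hpoBB, hpoRB]
    field_simp
    rw [hu, hu']
    ring
  have hB : p_in_BR = 1 - p_in_BB := by
    rw [hpiBR, hpiBB]
    field_simp
    rw [hD1]
    ring
  have hR : p_in_RR = 1 - p_in_RB := by
    rw [hpiRR, hpiRB]
    field_simp
    rw [hD2]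
    ring
  calc q_BB - q_RB = (p_in_BB - p_in_RB) * (p_out_BB - p_out_RB) := by
        rw [hqBB, hqRB, hB, hR]
        ring
    _ = r * (1 - r) * α * (1 - α) * (1 - ρ ^ 2) ^ 2 / (D1 * D2) := by
        rw [hin, hout]
        field_simp
end

section
/- Fix r ∈ (0, 1/2). For i = 1, 2 let ρ_i ∈ (0, 1] with ρ₁ ≤ ρ₂, and let α_i ∈ (0, 1) satisfy the BPAM fixed-point equation α_i = A_{ρ_i}(α_i). Writing q_BB(α, ρ) and q_RB(α, ρ) for the backward–forward step probabilities evaluated at parameters (α, ρ, r), the ratio F(ρ) := q_RB(α(ρ), ρ)/q_BB(α(ρ), ρ) is nondecreasing: F(ρ₁) ≤ F(ρ₂). Moreover F(1) = 1, i.e., when ρ = 1 one has q_RB = q_BB. (Proposition 3.5: in more homophilic networks, the minority's HITS multiplicative factor falls further below the majority's.) -/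
/-- The BPAM fixed-point map `A_ρ` for the asymptotic red-edge fraction. -/
noncomputable def bpamA (ρ r x : ℝ) : ℝ :=
  (1 / 2) * (r + r * x / (x + ρ * (1 - x)) + ρ * x * (1 - r) / (x * ρ + 1 - x))

/-- Backward–forward step probability `q_BB` in the BPAM, as a function of `(α, ρ, r)`. -/
noncomputable def bpamQBB (α ρ r : ℝ) : ℝ :=
  ((1 - r) * (α + ρ * (1 - α)) /
      (r * ρ * (α * ρ + 1 - α) + (1 - r) * (α + ρ * (1 - α)))) *
    ((1 - α) / (α * ρ + 1 - α)) +
  (r * ρ * (α * ρ + 1 - α) /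
      (r * ρ * (α * ρ + 1 - α) + (1 - r) * (α + ρ * (1 - α)))) *
    (ρ * (1 - α) / (α + ρ * (1 - α)))

/-- Backward–forward step probability `q_RB` in the BPAM, as a function of `(α, ρ, r)`. -/
noncomputable def bpamQRB (α ρ r : ℝ) : ℝ :=
  (ρ * (1 - r) * (α + ρ * (1 - α)) /
      (r * (α * ρ + 1 - α) + ρ * (1 - r) * (α + ρ * (1 - α)))) *
    ((1 - α) / (α * ρ + 1 - α)) +
  (r * (α * ρ + 1 - α) /
      (r * (α * ρ + 1 - α) + ρ * (1 - r) * (α + ρ * (1 - α)))) *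
    (ρ * (1 - α) / (α + ρ * (1 - α)))

/-- The defect `1 - q_RB / q_BB`, written in terms of `k = (1 - r) / r` and the ratio
`t = (α + ρ * (1 - α)) / (α * ρ + 1 - α)`. -/
noncomputable def bpamDefect (k ρ t : ℝ) : ℝ :=
  k * (1 - ρ ^ 2) * (t - ρ) / (k * t + ρ ^ 2 / t + ρ * k ^ 2 * t ^ 2 + ρ ^ 3 * k)

/-- The ratio `q_RB / q_BB` is one minus the defect; no fixed-point equation is needed. -/
lemma bpamQRB_div_bpamQBB {r ρ α : ℝ} (hr0 : 0 < r) (hr1 : r < 1) (hρ0 : 0 < ρ)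
    (hα0 : 0 < α) (hα1 : α < 1) :
    bpamQRB α ρ r / bpamQBB α ρ r =
      1 - bpamDefect ((1 - r) / r) ρ ((α + ρ * (1 - α)) / (α * ρ + 1 - α)) := by
  have hb : 0 < 1 - α := sub_pos.2 hα1
  have hs : 0 < 1 - r := sub_pos.2 hr1
  have hu : 0 < α * ρ + 1 - α := by nlinarith [mul_pos hα0 hρ0]
  have hv : 0 < α + ρ * (1 - α) := by positivity
  unfold bpamQRB bpamQBB bpamDefect
  generalize α * ρ + 1 - α = u at *
  generalize α + ρ * (1 - α) = v at *
  generalize 1 - α = b at *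
  generalize 1 - r = s at *
  have hD₁ : r * ρ * u + s * v ≠ 0 := by positivity
  have hD₂ : r * u + ρ * s * v ≠ 0 := by positivity
  have hB : s * v / (r * ρ * u + s * v) * (b / u) +
      r * ρ * u / (r * ρ * u + s * v) * (ρ * b / v) =
      b * (s * v ^ 2 + r * ρ ^ 2 * u ^ 2) / ((r * ρ * u + s * v) * u * v) := by
    field_simp
  have hR : ρ * s * v / (r * u + ρ * s * v) * (b / u) +
      r * u / (r * u + ρ * s * v) * (ρ * b / v) =
      ρ * b * (s * v ^ 2 + r * u ^ 2) / ((r * u + ρ * s * v) * u * v) := by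
    field_simp
  have hA : s / r * (v / u) + ρ ^ 2 / (v / u) + ρ * (s / r) ^ 2 * (v / u) ^ 2 + ρ ^ 3 * (s / r) =
      (r * u + ρ * s * v) * (s * v ^ 2 + r * ρ ^ 2 * u ^ 2) / (r ^ 2 * u ^ 2 * v) := by
    field_simp
    ring
  have hE : s * v ^ 2 + r * ρ ^ 2 * u ^ 2 ≠ 0 := by positivity
  rw [hB, hR, hA]
  field_simp
  ring

/-- The fixed-point equation in the coordinates
`t = (α + ρ * (1 - α)) / (α * ρ + 1 - α)` and `w = (t - ρ) / (1 + ρ)`. -/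
lemma exists_coord_of_eq_bpamA {r ρ α : ℝ} (hr0 : 0 < r) (hρ0 : 0 < ρ) (hρ1 : ρ < 1)
    (hα0 : 0 < α) (hα1 : α < 1) (hfix : α = bpamA ρ r α) :
    ∃ w t : ℝ, 0 < w ∧ t = (α + ρ * (1 - α)) / (α * ρ + 1 - α) ∧ t = ρ + (1 + ρ) * w ∧
      ρ * t < 1 ∧ (1 - r) / r = (1 - ρ * t) / (2 + ρ - ρ * t) * (1 / w + 1 / t) := by
  have hb : 0 < 1 - α := sub_pos.2 hα1
  have hc : 0 < 1 - ρ := sub_pos.2 hρ1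
  have hu : 0 < α * ρ + 1 - α := by nlinarith [mul_pos hα0 hρ0]
  have hv : 0 < α + ρ * (1 - α) := by positivity
  have hu' := hu.ne'
  have hv' := hv.ne'
  have hX : 1 - ρ * ((α + ρ * (1 - α)) / (α * ρ + 1 - α)) =
      (1 - α) * (1 - ρ) * (1 + ρ) / (α * ρ + 1 - α) := by
    rw [eq_div_iff hu', sub_mul, mul_assoc ρ, div_mul_cancel₀ _ hu']
    ring
  have hY : 2 + ρ - ρ * ((α + ρ * (1 - α)) / (α * ρ + 1 - α)) =
      (1 + ρ) * ((α * ρ + 1 - α) + (1 - α) * (1 - ρ)) / (α * ρ + 1 - α) := by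
    rw [eq_div_iff hu', sub_mul, mul_assoc ρ, div_mul_cancel₀ _ hu']
    ring
  refine ⟨α * (1 - ρ) / (α * ρ + 1 - α), _, by positivity, rfl, ?_, ?_, ?_⟩
  · field_simp
    ring
  · rw [← sub_pos, hX]
    positivity
  · have hZ : 0 < (α * ρ + 1 - α) + (1 - α) * (1 - ρ) := by positivity
    rw [hX, hY]
    unfold bpamA at hfix
    have h : 2 * α * (α + ρ * (1 - α)) * (α * ρ + 1 - α) =
        r * (α + ρ * (1 - α)) * (α * ρ + 1 - α) + r * α * (α * ρ + 1 - α)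
          + ρ * α * (1 - r) * (α + ρ * (1 - α)) := by
      generalize α * ρ + 1 - α = u at *
      generalize α + ρ * (1 - α) = v at *
      field_simp at hfix
      linear_combination hfix
    rw [div_eq_iff hr0.ne']
    have hZ' := hZ.ne'
    field_simp
    linear_combination h

/-- For fixed `k`, the coordinate `w` of the fixed point is nonincreasing in `ρ`. -/
lemma coord_antitone {k ρ₁ ρ₂ w₁ w₂ : ℝ} (hρ0 : 0 < ρ₁) (hρ : ρ₁ ≤ ρ₂) (hw₁ : 0 < w₁)
    (hX : ρ₂ * (ρ₂ + (1 + ρ₂) * w₂) < 1)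
    (h₁ : k = (1 - ρ₁ * (ρ₁ + (1 + ρ₁) * w₁)) / (2 + ρ₁ - ρ₁ * (ρ₁ + (1 + ρ₁) * w₁)) *
      (1 / w₁ + 1 / (ρ₁ + (1 + ρ₁) * w₁)))
    (h₂ : k = (1 - ρ₂ * (ρ₂ + (1 + ρ₂) * w₂)) / (2 + ρ₂ - ρ₂ * (ρ₂ + (1 + ρ₂) * w₂)) *
      (1 / w₂ + 1 / (ρ₂ + (1 + ρ₂) * w₂))) : w₂ ≤ w₁ := by
  by_contra! hlt
  have hw₂ : 0 < w₂ := hw₁.trans hlt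
  have hρ₂ : 0 < ρ₂ := hρ0.trans_le hρ
  have ht : ρ₁ + (1 + ρ₁) * w₁ ≤ ρ₂ + (1 + ρ₂) * w₂ := by gcongr
  have ht₁ : 0 < ρ₁ + (1 + ρ₁) * w₁ := by positivity
  generalize ρ₁ + (1 + ρ₁) * w₁ = t₁ at *
  generalize ρ₂ + (1 + ρ₂) * w₂ = t₂ at *
  have hp : ρ₁ * t₁ ≤ ρ₂ * t₂ := by gcongr
  have hfac : (1 - ρ₂ * t₂) / (2 + ρ₂ - ρ₂ * t₂) ≤ (1 - ρ₁ * t₁) / (2 + ρ₁ - ρ₁ * t₁) := by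
    rw [div_le_div_iff₀ (by linarith) (by linarith)]
    nlinarith
  have hinv : 1 / w₂ + 1 / t₂ < 1 / w₁ + 1 / t₁ :=
    add_lt_add_of_lt_of_le (one_div_lt_one_div_of_lt hw₁ hlt) (one_div_le_one_div_of_le ht₁ ht)
  have hpos : 0 < (1 - ρ₂ * t₂) / (2 + ρ₂ - ρ₂ * t₂) := div_pos (by linarith) (by linarith)
  have hi : 0 < 1 / w₁ + 1 / t₁ := by positivity
  have := (mul_lt_mul_of_pos_left hinv hpos).trans_le (mul_le_mul_of_nonneg_right hfac hi.le)
  linarith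

/-- At the fixed point, `k * (t - ρ) ≤ 1`. -/
lemma mul_coord_le_one {k ρ w : ℝ} (hρ0 : 0 < ρ) (hw : 0 < w)
    (hX : ρ * (ρ + (1 + ρ) * w) < 1)
    (h : k = (1 - ρ * (ρ + (1 + ρ) * w)) / (2 + ρ - ρ * (ρ + (1 + ρ) * w)) *
      (1 / w + 1 / (ρ + (1 + ρ) * w))) : k * ((1 + ρ) * w) ≤ 1 := by
  have ht : 0 < ρ + (1 + ρ) * w := by positivity
  have hfac : (1 - ρ * (ρ + (1 + ρ) * w)) / (2 + ρ - ρ * (ρ + (1 + ρ) * w)) ≤ 1 / (2 + ρ) := by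
    rw [div_le_div_iff₀ (by linarith) (by linarith)]
    nlinarith [mul_pos hρ0 ht]
  have hinv : (1 / w + 1 / (ρ + (1 + ρ) * w)) * ((1 + ρ) * w) ≤ 2 + ρ := by
    rw [div_add_div _ _ hw.ne' ht.ne', div_mul_eq_mul_div, div_le_iff₀ (by positivity)]
    nlinarith [mul_pos hρ0 hw]
  calc k * ((1 + ρ) * w) = (1 - ρ * (ρ + (1 + ρ) * w)) / (2 + ρ - ρ * (ρ + (1 + ρ) * w)) *
        ((1 / w + 1 / (ρ + (1 + ρ) * w)) * ((1 + ρ) * w)) := by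
        rw [← mul_assoc (_ / _) (_ + _), ← h]
    _ ≤ 1 / (2 + ρ) * (2 + ρ) := by gcongr
    _ = 1 := by field_simp

/-- As long as `k * (t - ρ) ≤ 1`, the defect is monotone in `t`. -/
lemma bpamDefect_mono_right {k ρ t t' : ℝ} (hk : 1 ≤ k) (hρ0 : 0 < ρ) (hρ1 : ρ < 1)
    (ht : ρ ≤ t) (htt : t ≤ t') (hkt : k * (t' - ρ) ≤ 1) :
    bpamDefect k ρ t ≤ bpamDefect k ρ t' := by
  have hk0 : 0 < k := by linarith
  have ht0 : 0 < t := by linarith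
  have ht0' : 0 < t' := by linarith
  have hc : 0 ≤ k * (1 - ρ ^ 2) := mul_nonneg hk0.le (by nlinarith)
  have hinv : (t - ρ) * (ρ ^ 2 / t') ≤ (t' - ρ) * (ρ ^ 2 / t) := by gcongr; linarith
  have hprod : (k * (t - ρ)) * (k * (t' - ρ)) ≤ 1 := by
    apply mul_le_one₀ _ (mul_nonneg hk0.le (by linarith)) hkt
    exact (mul_le_mul_of_nonneg_left (by linarith) hk0.le).trans hkt
  have hcoef : 0 ≤ ρ * (t' - t) * (k + k ^ 2 * ρ ^ 2 - (k * (t - ρ)) * (k * (t' - ρ))) := by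
    have := sq_nonneg (k * ρ)
    exact mul_nonneg (mul_nonneg hρ0.le (by linarith)) (by nlinarith)
  have hcube : 0 ≤ ρ ^ 3 * k * (t' - t) := mul_nonneg (by positivity) (by linarith)
  unfold bpamDefect
  rw [mul_div_assoc, mul_div_assoc]
  refine mul_le_mul_of_nonneg_left ?_ hc
  rw [div_le_div_iff₀ (by positivity) (by positivity)]
  linear_combination hinv + hcoef + hcube

/-- The defect as a function of `ρ`, `w` and `s = ρ / (1 + ρ)`. -/
lemma bpamDefect_coord {k ρ w : ℝ} (hk : 0 < k) (hρ0 : 0 < ρ) (hρ1 : ρ < 1) (hw : 0 < w) :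
    bpamDefect k ρ (ρ + (1 + ρ) * w) = k * w /
      (k * (w + ρ / (1 + ρ)) / (1 - ρ ^ 2) +
        (ρ / (1 + ρ)) ^ 2 / (w + ρ / (1 + ρ)) / (1 - ρ ^ 2) +
        ρ * k ^ 2 * (w + ρ / (1 + ρ)) ^ 2 / (1 - ρ) + k * ρ * (ρ / (1 + ρ)) ^ 2 / (1 - ρ)) := by
  have hc : 0 < 1 - ρ := sub_pos.2 hρ1
  have ht : 0 < ρ + (1 + ρ) * w := by positivity
  have hτ : w + ρ / (1 + ρ) = (ρ + (1 + ρ) * w) / (1 + ρ) := by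
    field_simp
    ring
  have hsq : 1 - ρ ^ 2 = (1 - ρ) * (1 + ρ) := by ring
  have hden : k * (w + ρ / (1 + ρ)) / (1 - ρ ^ 2) +
        (ρ / (1 + ρ)) ^ 2 / (w + ρ / (1 + ρ)) / (1 - ρ ^ 2) +
        ρ * k ^ 2 * (w + ρ / (1 + ρ)) ^ 2 / (1 - ρ) + k * ρ * (ρ / (1 + ρ)) ^ 2 / (1 - ρ) =
      (k * (ρ + (1 + ρ) * w) + ρ ^ 2 / (ρ + (1 + ρ) * w) + ρ * k ^ 2 * (ρ + (1 + ρ) * w) ^ 2 +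
        ρ ^ 3 * k) / ((1 + ρ) ^ 2 * (1 - ρ)) := by
    rw [hτ, hsq]
    generalize ρ + (1 + ρ) * w = t at *
    field_simp
  unfold bpamDefect
  rw [hden, hsq, add_sub_cancel_left]
  generalize ρ + (1 + ρ) * w = t at *
  have hA : k * t + ρ ^ 2 / t + ρ * k ^ 2 * t ^ 2 + ρ ^ 3 * k ≠ 0 := by positivity
  generalize k * t + ρ ^ 2 / t + ρ * k ^ 2 * t ^ 2 + ρ ^ 3 * k = A at *
  field_simp

/-- For fixed `w`, the defect is nonincreasing in `ρ`. -/
lemma bpamDefect_coord_antitone {k ρ₁ ρ₂ w : ℝ} (hk : 0 < k) (hρ0 : 0 < ρ₁) (hρ : ρ₁ ≤ ρ₂)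
    (hρ1 : ρ₂ < 1) (hw : 0 < w) :
    bpamDefect k ρ₂ (ρ₂ + (1 + ρ₂) * w) ≤ bpamDefect k ρ₁ (ρ₁ + (1 + ρ₁) * w) := by
  have hρ₂ : 0 < ρ₂ := hρ0.trans_le hρ
  rw [bpamDefect_coord hk hρ0 (hρ.trans_lt hρ1) hw, bpamDefect_coord hk hρ₂ hρ1 hw]
  have hs : ρ₁ / (1 + ρ₁) ≤ ρ₂ / (1 + ρ₂) := by
    rw [div_le_div_iff₀ (by positivity) (by positivity)]
    linarith
  have hs₁ : 0 < ρ₁ / (1 + ρ₁) := by positivity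
  have hs₂ : 0 < ρ₂ / (1 + ρ₂) := by positivity
  generalize ρ₁ / (1 + ρ₁) = s₁ at *
  generalize ρ₂ / (1 + ρ₂) = s₂ at *
  have hfrac : s₁ ^ 2 / (w + s₁) ≤ s₂ ^ 2 / (w + s₂) := by
    rw [div_le_div_iff₀ (by positivity) (by positivity)]
    have h₁ : s₁ ^ 2 * w ≤ s₂ ^ 2 * w := by gcongr
    have h₂ : s₁ * s₂ * s₁ ≤ s₁ * s₂ * s₂ := by gcongr
    linarith
  have hc₂ : 0 < 1 - ρ₂ := sub_pos.2 hρ1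
  have hc₁ : 0 < 1 - ρ₁ := by linarith
  have hd₂ : 0 < 1 - ρ₂ ^ 2 := by nlinarith
  have hd₁ : 0 < 1 - ρ₁ ^ 2 := by nlinarith
  gcongr

/-- Proposition 3.5: the ratio `F(ρ) = q_RB/q_BB` (evaluated at the fixed point `α(ρ)`)
is nondecreasing in the homophily parameter `ρ`, and `F(1) = 1`. -/
theorem bpam_hits_ratio_monotone_in_homophily
    (r : ℝ) (hr0 : 0 < r) (hr1 : r < 1 / 2)
    (ρ₁ ρ₂ α₁ α₂ : ℝ)
    (hρ₁0 : 0 < ρ₁) (hρ₁1 : ρ₁ ≤ 1) (hρ₂0 : 0 < ρ₂) (hρ₂1 : ρ₂ ≤ 1)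
    (hρ : ρ₁ ≤ ρ₂)
    (hα₁0 : 0 < α₁) (hα₁1 : α₁ < 1) (hα₂0 : 0 < α₂) (hα₂1 : α₂ < 1)
    (hfix₁ : α₁ = bpamA ρ₁ r α₁) (hfix₂ : α₂ = bpamA ρ₂ r α₂) :
    bpamQRB α₁ ρ₁ r / bpamQBB α₁ ρ₁ r ≤ bpamQRB α₂ ρ₂ r / bpamQBB α₂ ρ₂ r ∧
    ∀ α : ℝ, bpamQRB α 1 r = bpamQBB α 1 r := by
  refine ⟨?_, fun α => by simp only [bpamQRB, bpamQBB, one_mul, mul_one]⟩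
  have hk : 1 ≤ (1 - r) / r := by
    rw [le_div_iff₀ hr0]
    linarith
  have hk0 : 0 < (1 - r) / r := by linarith
  rw [bpamQRB_div_bpamQBB hr0 (by linarith) hρ₁0 hα₁0 hα₁1,
    bpamQRB_div_bpamQBB hr0 (by linarith) hρ₂0 hα₂0 hα₂1]
  refine sub_le_sub_left ?_ 1
  rcases hρ₁1.eq_or_lt with rfl | hlt₁
  · obtain rfl : ρ₂ = 1 := le_antisymm hρ₂1 hρ
    simp [bpamDefect]
  obtain ⟨w₁, t₁, hw₁, ht₁, rfl, hX₁, hk₁⟩ :=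
    exists_coord_of_eq_bpamA hr0 hρ₁0 hlt₁ hα₁0 hα₁1 hfix₁
  rw [← ht₁]
  rcases hρ₂1.eq_or_lt with rfl | hlt₂
  · have hd : 0 ≤ 1 - ρ₁ ^ 2 := by nlinarith
    have hz : 0 ≤ ρ₁ + (1 + ρ₁) * w₁ - ρ₁ := by
      rw [add_sub_cancel_left]
      positivity
    rw [show ∀ t, bpamDefect ((1 - r) / r) 1 t = 0 by simp [bpamDefect]]
    unfold bpamDefect
    positivity
  obtain ⟨w₂, t₂, hw₂, ht₂, rfl, hX₂, hk₂⟩ :=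
    exists_coord_of_eq_bpamA hr0 hρ₂0 hlt₂ hα₂0 hα₂1 hfix₂
  rw [← ht₂]
  have hw : w₂ ≤ w₁ := coord_antitone hρ₁0 hρ hw₁ hX₂ hk₁ hk₂
  calc bpamDefect ((1 - r) / r) ρ₂ (ρ₂ + (1 + ρ₂) * w₂)
      ≤ bpamDefect ((1 - r) / r) ρ₁ (ρ₁ + (1 + ρ₁) * w₂) :=
        bpamDefect_coord_antitone hk0 hρ₁0 hρ hlt₂ hw₂
    _ ≤ bpamDefect ((1 - r) / r) ρ₁ (ρ₁ + (1 + ρ₁) * w₁) := by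
        refine bpamDefect_mono_right hk hρ₁0 hlt₁ (le_add_of_nonneg_right (by positivity))
          (by gcongr) ?_
        rw [add_sub_cancel_left]
        exact mul_coord_le_one hρ₁0 hw₁ hX₁ hk₁
end

section
/- Let r ∈ (0, 1), ρ ∈ [0, 1], and let α ∈ (0, 1) satisfy the BPAM fixed-point equation α = A_ρ(α). Then K_R = 1 − r/(2α) and K_B = 1 − (1 − r)/(2(1 − α)). Consequently, K_R < 1/2 if and only if α < r, and K_B > 1/2 if and only if α < r; hence if α < r (the power inequality) and α > r/2, then 0 < K_R < 1/2 < K_B < 1, i.e., the power-law exponents satisfy β_R > 3 > β_B. -/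
/-- At the BPAM fixed point, `K_R = 1 − r/(2α)` and `K_B = 1 − (1−r)/(2(1−α))`;
consequently `K_R < 1/2 ↔ α < r` and `K_B > 1/2 ↔ α < r`, and under the power
inequality `α < r` together with `α > r/2`, one has `0 < K_R < 1/2 < K_B < 1`,
i.e. the power-law exponents satisfy `β_R > 3 > β_B`. -/
theorem bpam_KR_KB_closed_form
    (r ρ α : ℝ) (hr0 : 0 < r) (hr1 : r < 1) (hρ0 : 0 ≤ ρ) (hρ1 : ρ ≤ 1)
    (hα0 : 0 < α) (hα1 : α < 1) (hfix : α = bpamA ρ r α)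
    (u u' K_B K_R β_B β_R : ℝ)
    (hu : u = α * ρ + 1 - α) (hu' : u' = α + ρ * (1 - α))
    (hKB : K_B = (1 / 2) * (r * ρ / u' + (1 - r) / u))
    (hKR : K_R = (1 / 2) * (r / u' + ρ * (1 - r) / u))
    (hβB : β_B = 1 + 1 / K_B) (hβR : β_R = 1 + 1 / K_R) :
    K_R = 1 - r / (2 * α) ∧ K_B = 1 - (1 - r) / (2 * (1 - α)) ∧
    (K_R < 1 / 2 ↔ α < r) ∧ (K_B > 1 / 2 ↔ α < r) ∧
    (α < r → r / 2 < α →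
      0 < K_R ∧ K_R < 1 / 2 ∧ 1 / 2 < K_B ∧ K_B < 1 ∧ β_R > 3 ∧ 3 > β_B) := by
  have hu_pos : 0 < u := by rw [hu]; nlinarith [mul_nonneg hα0.le hρ0]
  have hu'_pos : 0 < u' := by
    rw [hu']; nlinarith [mul_nonneg hρ0 (sub_nonneg.2 hα1.le)]
  have h1α : 0 < 1 - α := sub_pos.2 hα1
  have hred : α * K_R = α - r / 2 := by
    have h : bpamA ρ r α = r / 2 + α * K_R := by
      rw [hKR, bpamA, ← hu, ← hu']; ring
    linarith
  have hsum : (1 - α) * K_B + α * K_R = 1 / 2 := by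
    have h : (1 - α) * K_B + α * K_R
        = (1 / 2) * (r * ((α + ρ * (1 - α)) / u') + (1 - r) * ((α * ρ + 1 - α) / u)) := by
      rw [hKB, hKR]; ring
    rw [h, ← hu, ← hu', div_self hu_pos.ne', div_self hu'_pos.ne']; ring
  have hblue : (1 - α) * K_B = (1 - α) - (1 - r) / 2 := by linarith
  have hR_iff : K_R < 1 / 2 ↔ α < r := by
    rw [← mul_lt_mul_iff_right₀ hα0, hred]
    constructor <;> intro h <;> linarith
  have hB_iff : K_B > 1 / 2 ↔ α < r := by
    rw [gt_iff_lt, ← mul_lt_mul_iff_right₀ h1α, hblue]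
    constructor <;> intro h <;> linarith
  refine ⟨?_, ?_, hR_iff, hB_iff, fun hlt hgt => ?_⟩
  · field_simp
    linarith
  · field_simp
    linarith
  · have hR := hR_iff.2 hlt
    have hB : 1 / 2 < K_B := hB_iff.2 hlt
    have hR_pos : 0 < K_R := pos_of_mul_pos_right (by linarith : 0 < α * K_R) hα0.le
    have hB_lt : K_B < 1 := by
      rw [← mul_lt_mul_iff_right₀ h1α, hblue]; linarith
    refine ⟨hR_pos, hR, hB, hB_lt, ?_, ?_⟩
    · have : 2 < 1 / K_R := by rw [lt_div_iff₀ hR_pos]; linarith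
      linarith
    · have : 1 / K_B < 2 := by rw [div_lt_iff₀ (by linarith)]; linarith
      linarith
end

section
/- Assume 0 ≤ α < r ≤ 1/2, 0 ≤ ρ ≤ 1, and u' = α + ρ·(1 − α) > 0. Then K_B < 1; equivalently (since K_B > 0), the blue power-law exponent satisfies β_B = 1 + 1/K_B > 2. (Proposition A.1.) -/
/-- Proposition A.1: under the power inequality `0 ≤ α < r ≤ 1/2`, `0 ≤ ρ ≤ 1`,
and `u' > 0`, we have `K_B < 1`, equivalently `β_B = 1 + 1/K_B > 2`. -/
theorem bpam_betaB_gt_two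
    (α r ρ : ℝ) (hα0 : 0 ≤ α) (hαr : α < r) (hr : r ≤ 1 / 2)
    (hρ0 : 0 ≤ ρ) (hρ1 : ρ ≤ 1)
    (u u' K_B β_B : ℝ)
    (hu : u = α * ρ + 1 - α) (hu' : u' = α + ρ * (1 - α)) (hu'pos : 0 < u')
    (hKB : K_B = (1 / 2) * (r * ρ / u' + (1 - r) / u))
    (hβB : β_B = 1 + 1 / K_B) :
    K_B < 1 ∧ β_B > 2 := by
  have hu_gt : 1 - r < u := by nlinarith [mul_nonneg hα0 hρ0]
  have hu_pos : 0 < u := by linarith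
  have hρu' : ρ ≤ u' := by nlinarith [mul_nonneg hα0 (sub_nonneg.2 hρ1)]
  have hr0 : 0 ≤ r := by linarith
  have h_red : r * ρ / u' ≤ r := by
    rw [div_le_iff₀ hu'pos]
    exact mul_le_mul_of_nonneg_left hρu' hr0
  have h_blue : (1 - r) / u < 1 := (div_lt_one hu_pos).2 hu_gt
  have h_red_nonneg : 0 ≤ r * ρ / u' := by positivity
  have h_blue_pos : 0 < (1 - r) / u := div_pos (by linarith) hu_pos
  have hK_pos : 0 < K_B := by linarith
  have hK_lt : K_B < 1 := by linarith
  have h_inv : 1 < 1 / K_B := (one_lt_div hK_pos).2 hK_lt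
  exact ⟨hK_lt, by linarith⟩
end

section
/- Assume 0 ≤ α < r < 1, 0 ≤ ρ ≤ 1, and u' = α + ρ·(1 − α) > 0. Then 2·K_B − 1 < K_R; equivalently, 1/(β_R − 1) > 2/(β_B − 1) − 1. (Proposition A.2.) -/
/-- Proposition A.2: under `0 ≤ α < r < 1`, `0 ≤ ρ ≤ 1`, and `u' > 0`,
we have `2·K_B − 1 < K_R`, equivalently `1/(β_R − 1) > 2/(β_B − 1) − 1`. -/
theorem bpam_KB_KR_inequality
    (α r ρ : ℝ) (hα0 : 0 ≤ α) (hαr : α < r) (hr1 : r < 1)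
    (hρ0 : 0 ≤ ρ) (hρ1 : ρ ≤ 1)
    (u u' K_B K_R β_B β_R : ℝ)
    (hu : u = α * ρ + 1 - α) (hu' : u' = α + ρ * (1 - α)) (hu'pos : 0 < u')
    (hKB : K_B = (1 / 2) * (r * ρ / u' + (1 - r) / u))
    (hKR : K_R = (1 / 2) * (r / u' + ρ * (1 - r) / u))
    (hβB : β_B = 1 + 1 / K_B) (hβR : β_R = 1 + 1 / K_R) :
    2 * K_B - 1 < K_R ∧ 1 / (β_R - 1) > 2 / (β_B - 1) - 1 := by
  have hu_pos : 0 < u := by nlinarith [mul_nonneg hα0 hρ0]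
  have hα1 : 0 < 1 - α := by linarith
  -- The cleared inequality is affine in `r`: interpolate between `r = α` and `r = 1`.
  have at_alpha : 0 ≤ ρ ^ 2 + α * (1 - ρ) * (1 - α + 3 * α * ρ) := by
    have := sub_nonneg.2 hρ1
    positivity
  have at_one : 0 < u * (1 + 2 * α * (1 - ρ)) := by
    have := sub_nonneg.2 hρ1
    positivity
  have interpolation : (1 - α) * (2 * u * u' - r * (2 * ρ - 1) * u - (1 - r) * (2 - ρ) * u') =
      (1 - r) * (ρ ^ 2 + α * (1 - ρ) * (1 - α + 3 * α * ρ)) +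
        (r - α) * (u * (1 + 2 * α * (1 - ρ))) := by
    subst hu hu'
    ring
  have cleared : 0 < 2 * u * u' - r * (2 * ρ - 1) * u - (1 - r) * (2 - ρ) * u' := by
    refine pos_of_mul_pos_right ?_ hα1.le
    rw [interpolation]
    exact add_pos_of_nonneg_of_pos (mul_nonneg (by linarith) at_alpha)
      (mul_pos (by linarith) at_one)
  have main : 2 * K_B - 1 < K_R := by
    have difference : K_R - (2 * K_B - 1) =
        (2 * u * u' - r * (2 * ρ - 1) * u - (1 - r) * (2 - ρ) * u') / (2 * u * u') := by
      rw [hKB, hKR]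
      field_simp
      ring
    rw [← sub_pos, difference]
    positivity
  refine ⟨main, ?_⟩
  have inv_R : 1 / (β_R - 1) = K_R := by simp [hβR]
  have inv_B : 2 / (β_B - 1) = 2 * K_B := by simp [hβB]
  rw [inv_R, inv_B]
  exact main
end

section
/- Let r ∈ (0, 1), ρ ∈ (0, 1], and let α ∈ (0, 1) satisfy the BPAM fixed-point equation α = A_ρ(α), and assume 2α − r ≠ 0. Then the ratio of backward–forward step probabilities admits the closed form q_RB / q_BB = (α/(1 − α)) · ((1 + r − 2α)/(2α − r)) · ( ρ·(1 − r)·u'² + ρ·r·u² ) / ( (1 − r)·u'² + ρ²·r·u² ). (Closed form for F(ρ) from the proof of Proposition A.3, part 2.) -/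
/-- Closed form for the ratio `F(ρ) = q_RB/q_BB` at the BPAM fixed point
(proof of Proposition A.3, part 2). -/
theorem bpam_ratio_closed_form
    (r ρ α : ℝ) (hr0 : 0 < r) (hr1 : r < 1) (hρ0 : 0 < ρ) (hρ1 : ρ ≤ 1)
    (hα0 : 0 < α) (hα1 : α < 1) (hfix : α = bpamA ρ r α) (hne : 2 * α - r ≠ 0)
    (u u' D1 D2 p_out_BB p_out_RB p_in_BB p_in_BR p_in_RR p_in_RB q_BB q_RB : ℝ)
    (hu : u = α * ρ + 1 - α) (hu' : u' = α + ρ * (1 - α))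
    (hD1 : D1 = r * ρ * u + (1 - r) * u') (hD2 : D2 = r * u + ρ * (1 - r) * u')
    (hpoBB : p_out_BB = (1 - α) / u) (hpoRB : p_out_RB = ρ * (1 - α) / u')
    (hpiBB : p_in_BB = (1 - r) * u' / D1) (hpiBR : p_in_BR = r * ρ * u / D1)
    (hpiRR : p_in_RR = r * u / D2) (hpiRB : p_in_RB = ρ * (1 - r) * u' / D2)
    (hqBB : q_BB = p_in_BB * p_out_BB + p_in_BR * p_out_RB)
    (hqRB : q_RB = p_in_RB * p_out_BB + p_in_RR * p_out_RB) :
    q_RB / q_BB =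
      (α / (1 - α)) * ((1 + r - 2 * α) / (2 * α - r)) *
        ((ρ * (1 - r) * u' ^ 2 + ρ * r * u ^ 2) /
          ((1 - r) * u' ^ 2 + ρ ^ 2 * r * u ^ 2)) := by
  have h1α : 0 < 1 - α := by linarith
  have h1r : 0 < 1 - r := by linarith
  have hupos : 0 < u := by rw [hu]; nlinarith [mul_pos hα0 hρ0]
  have hu'pos : 0 < u' := by rw [hu']; positivity
  have hD1pos : 0 < D1 := by rw [hD1]; positivity
  have hD2pos : 0 < D2 := by rw [hD2]; positivity
  have hM : 0 < (1 - r) * u' ^ 2 + ρ ^ 2 * r * u ^ 2 := by positivity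
  have hred : 2 * α - r = α * D2 / (u * u') := by
    have h : 2 * α - r = r * α / u' + ρ * α * (1 - r) / u := by
      rw [bpamA, ← hu', ← hu] at hfix
      linarith
    rw [h, hD2]
    field_simp
  have hblue : 1 + r - 2 * α = (1 - α) * D1 / (u * u') := by
    have h : α * D2 + (1 - α) * D1 = u * u' := by
      rw [hD1, hD2, hu, hu']
      ring
    have h' : 1 + r - 2 * α = 1 - (2 * α - r) := by ring
    rw [h', hred, eq_div_iff (by positivity), sub_mul, div_mul_cancel₀ _ (by positivity)]
    linarith
  have hqRB' : q_RB = (1 - α) * (ρ * (1 - r) * u' ^ 2 + ρ * r * u ^ 2) / (u * u' * D2) := by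
    rw [hqRB, hpiRB, hpoBB, hpiRR, hpoRB]
    field_simp
  have hqBB' : q_BB = (1 - α) * ((1 - r) * u' ^ 2 + ρ ^ 2 * r * u ^ 2) / (u * u' * D1) := by
    rw [hqBB, hpiBB, hpoBB, hpiBR, hpoRB]
    field_simp
  rw [hqRB', hqBB', hred, hblue]
  clear hred hblue hqRB' hqBB' hu hu' hD1 hD2
  field_simp
end

section
/- For r ∈ (0, 1) and ρ ∈ [0, 1], the BPAM fixed-point map satisfies A_ρ(r) − r = r·ρ·(1 − r)·(2r − 1)·(1 − ρ) / ( 2·(r + ρ·(1 − r))·(1 − r + r·ρ) ). In particular, if r ∈ (0, 1/2) and ρ ∈ (0, 1), then A_ρ(r) < r. (Step toward the power inequality α < r: the map lies below the diagonal at x = r.) -/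
/-- Step toward the power inequality `α < r`: the BPAM fixed-point map lies below
the diagonal at `x = r`. -/
theorem bpam_A_below_diagonal_at_r
    (r ρ : ℝ) (hr0 : 0 < r) (hr1 : r < 1) (hρ0 : 0 ≤ ρ) (hρ1 : ρ ≤ 1) :
    bpamA ρ r r - r =
      r * ρ * (1 - r) * (2 * r - 1) * (1 - ρ) /
        (2 * (r + ρ * (1 - r)) * (1 - r + r * ρ)) ∧
    (r < 1 / 2 → 0 < ρ → ρ < 1 → bpamA ρ r r < r) := by
  have hD : 0 < r + ρ * (1 - r) := by nlinarith
  have hE : 0 < 1 - r + r * ρ := by nlinarith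
  have key : bpamA ρ r r - r =
      r * ρ * (1 - r) * (2 * r - 1) * (1 - ρ) /
        (2 * (r + ρ * (1 - r)) * (1 - r + r * ρ)) := by
    have hE' : r * ρ + 1 - r = 1 - r + r * ρ := by ring
    rw [bpamA, hE', eq_div_iff (by positivity)]
    have hD0 := hD.ne'
    have hE0 := hE.ne'
    field_simp
    ring
  refine ⟨key, fun hr hρ hρ' => sub_neg.mp ?_⟩
  rw [key]
  refine div_neg_of_neg_of_pos ?_ (by positivity)
  have hr1' : 0 < 1 - r := sub_pos.mpr hr1
  exact mul_neg_of_neg_of_pos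
    (mul_neg_of_pos_of_neg (by positivity) (by linarith)) (sub_pos.mpr hρ')
end
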